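/- arXiv:2505.09719 — 2 statements merged into one kernel-verified Lean document; each statement's English description precedes it below -/
import Mathlib

section
/- Let G be a finite connected loopless graph with at least two vertices, of genus g = |E(G)| − |V(G)| + 1. Then there exists a generic numerical polarization φ of degree g on G such that n(φ)_W = g(G[W]) for every nontrivial biconnected W ⊆ V(G); consequently the set of integral break divisors of G arises from a generic numerical polarization (i.e., it is a classical stability condition). -/
open Finset

open scoped Classical

section MultiGraph

variable {V E : Type*} [Fintype V] [Fintype E] [DecidableEq V] [DecidableEq E]

/-- Degree of a vertex in the loopless multigraph with edge-endpoint maps `s`, `t`. -/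
def deg (s t : E → V) (v : V) : ℕ :=
  (Finset.univ.filter fun e => s e = v).card + (Finset.univ.filter fun e => t e = v).card

/-- Edges with both endpoints in `W` (edge set of the induced subgraph `G[W]`). -/
def inEdges (s t : E → V) (W : Finset V) : Finset E :=
  Finset.univ.filter fun e => s e ∈ W ∧ t e ∈ W

/-- Edges with exactly one endpoint in `W` (the cut `E(W, Wᶜ)`). -/
def cutEdges (s t : E → V) (W : Finset V) : Finset E :=
  Finset.univ.filter fun e => (s e ∈ W ∧ t e ∉ W) ∨ (s e ∉ W ∧ t e ∈ W)

/-- Edges with one endpoint in `A` and the other in `B`. -/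
def betweenEdges (s t : E → V) (A B : Finset V) : Finset E :=
  Finset.univ.filter fun e => (s e ∈ A ∧ t e ∈ B) ∨ (s e ∈ B ∧ t e ∈ A)

/-- Reachability using only edges in `F`. -/
def Reach (s t : E → V) (F : Finset E) (a b : V) : Prop :=
  Relation.ReflTransGen (fun x y => ∃ e ∈ F, (s e = x ∧ t e = y) ∨ (s e = y ∧ t e = x)) a b

/-- The vertex set `W` is nonempty and connected using the edges in `F`. -/
def ConnOn (s t : E → V) (F : Finset E) (W : Finset V) : Prop :=
  W.Nonempty ∧ ∀ a ∈ W, ∀ b ∈ W, Reach s t F a b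

/-- The induced subgraph `G[W]` is connected. -/
def IndConn (s t : E → V) (W : Finset V) : Prop :=
  ConnOn s t (inEdges s t W) W

/-- `W` is biconnected: both `G[W]` and `G[Wᶜ]` are connected (hence `W` is nontrivial). -/
def Biconn (s t : E → V) (W : Finset V) : Prop :=
  IndConn s t W ∧ IndConn s t Wᶜ

/-- The genus `g(G) = |E| - |V| + 1` of the multigraph. -/
def genus (_s _t : E → V) : ℤ := (Fintype.card E : ℤ) - Fintype.card V + 1

/-- The genus `g(G[W]) = |E(G[W])| - |W| + 1` of the induced subgraph on `W`. -/
def indGenus (s t : E → V) (W : Finset V) : ℤ := ((inEdges s t W).card : ℤ) - W.card + 1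

/-- The polarization `φ_pcan(v) = ((|E|+1)/(2|E|))·deg(v) − 1`. -/
noncomputable def pcan (s t : E → V) (v : V) : ℝ :=
  ((Fintype.card E + 1 : ℝ) / (2 * Fintype.card E)) * deg s t v - 1

/-- A spanning tree: a connected spanning subgraph with `|V| - 1` edges. -/
def IsSpanningTree (s t : E → V) (T : Finset E) : Prop :=
  ConnOn s t T Finset.univ ∧ T.card + 1 = Fintype.card V

/-- For `e ∈ T`, the vertex set of the component of `T ∖ e` containing `s e`. -/
noncomputable def treeSide (s t : E → V) (T : Finset E) (e : E) : Finset V :=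
  Finset.univ.filter fun v => Reach s t (T.erase e) (s e) v

/-- The head of the edge `e` under the orientation `o`
(`o e = true` means `e` is directed from `s e` to `t e`, i.e. as in the reference orientation). -/
def ohead (s t : E → V) (o : E → Bool) (e : E) : V := if o e then t e else s e

/-- A cocycle signature, encoded as a choice, for each `W`, of a coherent orientation of the
cut `E(W,Wᶜ)`: `σ W = true` means all edges of the cut are directed towards `W`. -/
def IsSignature (s t : E → V) (σ : Finset V → Bool) : Prop :=
  ∀ W : Finset V, Biconn s t W → σ Wᶜ = ! σ W

/-- The orientation `T⃗*_σ` of a spanning tree `T`: each `e ∈ T` is directed as it is in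
`σ(C*(T,e))`, where `C*(T,e)` is the fundamental cocycle `E(W_e, W_eᶜ)` with `W_e ∋ s e`. -/
noncomputable def sigmaOrient (s t : E → V) (σ : Finset V → Bool) (T : Finset E) : E → Bool :=
  fun e => ! σ (treeSide s t T e)

/-- `σ` is triangulating: for every spanning tree `T`, every cocycle `E(W,Wᶜ)` (for biconnected
`W`) and every coherent orientation of it (towards `W` iff `b`), if every edge of the cocycle
lying in `T` is directed in `σ(C*(T,e))` the same way as in that coherent orientation, then `σ`
assigns that orientation to the cocycle. -/
noncomputable def Triangulating (s t : E → V) (σ : Finset V → Bool) : Prop :=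
  ∀ T : Finset E, IsSpanningTree s t T → ∀ W : Finset V, Biconn s t W → ∀ b : Bool,
    (∀ e ∈ cutEdges s t W ∩ T, (ohead s t (sigmaOrient s t σ T) e ∈ W ↔ b = true)) →
    σ W = b

/-- The vector in `ℝ^E` associated to the coherently oriented cocycle `σ(E(W,Wᶜ))`:
`+1` on edges directed as in the reference orientation, `-1` on edges directed oppositely,
`0` off the cocycle. -/
noncomputable def cocycVec (s t : E → V) (σ : Finset V → Bool) (W : Finset V) : E → ℝ :=
  fun e =>
    if s e ∈ W ∧ t e ∉ W then (if σ W then -1 else 1)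
    else if s e ∉ W ∧ t e ∈ W then (if σ W then 1 else -1)
    else 0

/-- `σ` is acyclic: the only nonnegative reals `a_W`, supported on the (biconnected) cocycles,
with `Σ_W a_W · σ(E(W,Wᶜ)) = 0` in `ℝ^E` are all zero. -/
def AcyclicSig (s t : E → V) (σ : Finset V → Bool) : Prop :=
  ∀ a : Finset V → ℝ, (∀ W, 0 ≤ a W) → (∀ W, ¬ Biconn s t W → a W = 0) →
    (∑ W : Finset V, a W • cocycVec s t σ W) = 0 → ∀ W, a W = 0

/-- The degree-zero divisor `I_G^σ(T)(v) = indeg_{T⃗*_σ}(v) − 1 + [v = q]`. -/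
noncomputable def IG (s t : E → V) (σ : Finset V → Bool) (q : V) (T : Finset E) : V → ℤ :=
  fun v => ((T.filter fun e => ohead s t (sigmaOrient s t σ T) e = v).card : ℤ) - 1
    + (if v = q then 1 else 0)

/-- The break divisor `D(T, O_E)`: its value at `v` is the number of edges outside `T`
whose head under the orientation `o` is `v`. -/
def breakDiv (s t : E → V) (T : Finset E) (o : E → Bool) : V → ℤ :=
  fun v => ((Finset.univ.filter fun e => e ∉ T ∧ ohead s t o e = v).card : ℤ)

/-- The set of generalized break divisors `BD_{I_G^σ}(G)`. -/
noncomputable def BDset (s t : E → V) (σ : Finset V → Bool) (q : V) : Set (V → ℤ) :=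
  { D | ∃ T : Finset E, ∃ o : E → Bool, IsSpanningTree s t T ∧
      D = fun v => breakDiv s t T o v + IG s t σ q T v }

/-- The graph Laplacian acting on `ℤ^V`. -/
def lap (s t : E → V) (f : V → ℤ) : V → ℤ :=
  fun v => ∑ e : E, ((if s e = v then 1 else 0) - (if t e = v then 1 else 0)) * (f (s e) - f (t e))

/-- Linear (chip-firing) equivalence of divisors. -/
def LinEquiv (s t : E → V) (D D' : V → ℤ) : Prop :=
  ∃ f : V → ℤ, ∀ v, D v - D' v = lap s t f v

/-- A numerical polarization `φ` is generic if `φ_W − |E(W,Wᶜ)|/2 ∉ ℤ` for every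
nontrivial biconnected `W`. -/
def Generic (s t : E → V) (φ : V → ℝ) : Prop :=
  ∀ W : Finset V, Biconn s t W →
    ∀ n : ℤ, (∑ v ∈ W, φ v) - (cutEdges s t W).card / 2 ≠ (n : ℝ)

/-- `n(φ)_W = ⌈φ_W − |E(W,Wᶜ)|/2⌉`. -/
noncomputable def nphi (s t : E → V) (φ : V → ℝ) (W : Finset V) : ℤ :=
  ⌈(∑ v ∈ W, φ v) - (cutEdges s t W).card / 2⌉

end MultiGraph

section PseudoCanonical

variable {V E : Type*} [Fintype E] [DecidableEq V]

theorem sum_deg_eq (s t : E → V) (W : Finset V) :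
    ∑ v ∈ W, deg s t v = 2 * (inEdges s t W).card + (cutEdges s t W).card := by
  have fiber : ∀ f : E → V, ∑ v ∈ W, (Finset.univ.filter fun e => f e = v).card
      = ∑ e : E, if f e ∈ W then 1 else 0 := by
    intro f
    simp only [Finset.card_filter]
    rw [Finset.sum_comm]
    simp
  simp only [deg, Finset.sum_add_distrib, fiber]
  simp only [inEdges, cutEdges, Finset.card_filter]
  rw [Finset.mul_sum, ← Finset.sum_add_distrib, ← Finset.sum_add_distrib]
  refine Finset.sum_congr rfl fun e _ => ?_
  by_cases hs : s e ∈ W <;> by_cases ht : t e ∈ W <;> simp [hs, ht]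

theorem card_inEdges_add_card_cutEdges_le (s t : E → V) (W : Finset V) :
    (inEdges s t W).card + (cutEdges s t W).card ≤ Fintype.card E := by
  rw [← Finset.card_union_of_disjoint]
  · exact Finset.card_le_univ _
  · rw [Finset.disjoint_left]
    intro e
    simp only [inEdges, cutEdges, Finset.mem_filter]
    tauto

/-- In a connected graph, every cut separating two vertices is nonempty. -/
theorem cutEdges_nonempty [Fintype V] (s t : E → V) (hconn : ConnOn s t Finset.univ Finset.univ)
    {W : Finset V} (hW : W.Nonempty) (hW' : Wᶜ.Nonempty) : (cutEdges s t W).Nonempty := by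
  obtain ⟨a, ha⟩ := hW
  obtain ⟨b, hb⟩ := hW'
  by_contra hne
  rw [Finset.not_nonempty_iff_eq_empty] at hne
  have hiff : ∀ e, s e ∈ W ↔ t e ∈ W := by
    intro e
    have he : e ∉ cutEdges s t W := by simp [hne]
    simp only [cutEdges, Finset.mem_filter, Finset.mem_univ, true_and] at he
    tauto
  have hreach : ∀ x, Reach s t Finset.univ a x → x ∈ W := by
    intro x hx
    induction hx with
    | refl => exact ha
    | tail _ hstep ih =>
      obtain ⟨e, -, ⟨rfl, rfl⟩ | ⟨rfl, rfl⟩⟩ := hstep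
      · exact (hiff e).1 ih
      · exact (hiff e).2 ih
  exact Finset.mem_compl.1 hb (hreach b (hconn.2 a (Finset.mem_univ a) b (Finset.mem_univ b)))

theorem sum_pcan (s t : E → V) (W : Finset V) :
    ∑ v ∈ W, pcan s t v = (Fintype.card E + 1 : ℝ) / (2 * Fintype.card E) *
      (2 * (inEdges s t W).card + (cutEdges s t W).card) - W.card := by
  have h : (∑ v ∈ W, (deg s t v : ℝ))
      = 2 * (inEdges s t W).card + (cutEdges s t W).card := by
    exact_mod_cast sum_deg_eq s t W
  simp only [pcan, Finset.sum_sub_distrib, ← Finset.mul_sum, h]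
  simp

/-- For a nontrivial `W` in a connected graph, `φ_W − |E(W,Wᶜ)|/2` lies strictly between
`g(G[W]) − 1` and `g(G[W])`, where `φ` is the polarization `pcan`. -/
theorem sum_pcan_sub_mem_Ioo [Fintype V] (s t : E → V) (hconn : ConnOn s t Finset.univ Finset.univ)
    {W : Finset V} (hW : W.Nonempty) (hW' : Wᶜ.Nonempty) :
    (∑ v ∈ W, pcan s t v) - (cutEdges s t W).card / 2 ∈
      Set.Ioo ((indGenus s t W : ℝ) - 1) (indGenus s t W) := by
  have hcut : (0 : ℝ) < (cutEdges s t W).card := by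
    exact_mod_cast (cutEdges_nonempty s t hconn hW hW').card_pos
  have hle : ((inEdges s t W).card : ℝ) + (cutEdges s t W).card ≤ Fintype.card E := by
    exact_mod_cast card_inEdges_add_card_cutEdges_le s t W
  have hin : (0 : ℝ) ≤ (inEdges s t W).card := Nat.cast_nonneg _
  have hE : (0 : ℝ) < Fintype.card E := by linarith
  rw [sum_pcan]
  simp only [indGenus]
  push_cast
  generalize ((inEdges s t W).card : ℝ) = i at *
  generalize ((cutEdges s t W).card : ℝ) = c at *
  generalize (Fintype.card E : ℝ) = m at *
  have hsplit : (m + 1) / (2 * m) * (2 * i + c) = i + c / 2 + (2 * i + c) / (2 * m) := by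
    field_simp
  have hpos : 0 < (2 * i + c) / (2 * m) := by positivity
  have hlt : (2 * i + c) / (2 * m) < 1 := by
    rw [div_lt_one (by positivity)]
    linarith
  rw [hsplit]
  constructor <;> linarith

end PseudoCanonical

section Statements

variable {V E : Type*} [Fintype V] [Fintype E] [DecidableEq V] [DecidableEq E]

/-- There is a generic numerical polarization `φ` of degree `g` with
`n(φ)_W = g(G[W])` for every nontrivial biconnected `W`; consequently the integral break
divisors form a classical stability condition. -/
theorem stmt_11 (s t : E → V) (hloop : ∀ e, s e ≠ t e)
    (hconn : ConnOn s t Finset.univ Finset.univ) (hcard : 2 ≤ Fintype.card V) :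
    ∃ φ : V → ℝ, (∑ v : V, φ v) = (Fintype.card E : ℝ) - Fintype.card V + 1 ∧
      Generic s t φ ∧
      ∀ W : Finset V, Biconn s t W → nphi s t φ W = indGenus s t W := by
  have hmem : ∀ W : Finset V, Biconn s t W →
      (∑ v ∈ W, pcan s t v) - (cutEdges s t W).card / 2 ∈
        Set.Ioo ((indGenus s t W : ℝ) - 1) (indGenus s t W) := fun W hW =>
    sum_pcan_sub_mem_Ioo s t hconn hW.1.1 hW.2.1
  refine ⟨pcan s t, ?_, ?_, ?_⟩
  · obtain ⟨a, b, hab⟩ := Fintype.one_lt_card_iff.1 (show 1 < Fintype.card V by omega)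
    have hcut := cutEdges_nonempty s t hconn (Finset.singleton_nonempty a)
      ⟨b, by simpa using hab.symm⟩
    obtain ⟨e, -⟩ := hcut
    have hE : (Fintype.card E : ℝ) ≠ 0 := by
      exact_mod_cast (Fintype.card_pos_iff.2 ⟨e⟩).ne'
    rw [sum_pcan]
    simp only [inEdges, cutEdges, Finset.mem_univ, not_true_eq_false, and_self, and_false,
      false_and, or_self, Finset.filter_true, Finset.filter_false, Finset.card_empty,
      Finset.card_univ, Nat.cast_zero, add_zero]
    field_simp
    ring
  · intro W hW n hn
    obtain ⟨h₁, h₂⟩ := hmem W hW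
    rw [hn] at h₁ h₂
    have h₃ : indGenus s t W - 1 < n := by exact_mod_cast h₁
    have h₄ : n < indGenus s t W := by exact_mod_cast h₂
    omega
  · intro W hW
    obtain ⟨h₁, h₂⟩ := hmem W hW
    exact Int.ceil_eq_iff.2 ⟨h₁, h₂.le⟩

end Statements
end

section
/- Let G be a finite connected loopless graph, and let σ1* and σ2* be triangulating cocycle signatures of G that differ by a cocycle flip at the cocycle C*: σ1*(C) = σ2*(C) for every cocycle C ≠ C*, and σ2*(C*) is the reverse of σ1*(C*). Then every spanning tree T of G with the property that each edge e ∈ C* ∩ T is directed in σ1*(C*(T,e)) the same way as in σ1*(C*) contains exactly one edge of C*, i.e. |C* ∩ T| = 1. -/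
open Finset

open scoped Classical

section Reachability

variable {V E : Type*} {s t : E → V} {F : Finset E}

theorem Reach.of_edge {e : E} (he : e ∈ F) : Reach s t F (s e) (t e) :=
  Relation.ReflTransGen.single ⟨e, he, Or.inl ⟨rfl, rfl⟩⟩

theorem Reach.symm {a b : V} (h : Reach s t F a b) : Reach s t F b a := by
  induction h with
  | refl => exact Relation.ReflTransGen.refl
  | tail _ hstep ih =>
    obtain ⟨e, he, h⟩ := hstep
    exact Relation.ReflTransGen.head ⟨e, he, h.symm⟩ ih

/-- Along edges of `F ∖ e`, one reaches from an endpoint of `e` whatever `F` reaches from `s e`. -/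
theorem Reach.erase [DecidableEq E] {e : E} {v : V} (h : Reach s t F (s e) v) :
    Reach s t (F.erase e) (s e) v ∨ Reach s t (F.erase e) (t e) v := by
  induction h with
  | refl => exact Or.inl Relation.ReflTransGen.refl
  | tail _ hstep ih =>
    obtain ⟨f, hf, hfe⟩ := hstep
    by_cases hef : f = e
    · subst hef
      rcases hfe with ⟨_, rfl⟩ | ⟨rfl, _⟩
      · exact Or.inr Relation.ReflTransGen.refl
      · exact Or.inl Relation.ReflTransGen.refl
    · have hf' : f ∈ F.erase e := Finset.mem_erase.2 ⟨hef, hf⟩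
      exact ih.imp (fun h => h.tail ⟨f, hf', hfe⟩) (fun h => h.tail ⟨f, hf', hfe⟩)

/-- A path of `F` starting in a set `W` which no edge of `F` leaves stays inside `G[W]`. -/
theorem Reach.inEdges [Fintype E] [DecidableEq V] {W : Finset V}
    (hW : ∀ e ∈ F, (s e ∈ W ↔ t e ∈ W)) {a b : V} (ha : a ∈ W) (h : Reach s t F a b) :
    b ∈ W ∧ Reach s t (inEdges s t W) a b := by
  induction h with
  | refl => exact ⟨ha, Relation.ReflTransGen.refl⟩
  | tail _ hstep ih =>
    obtain ⟨e, he, hab⟩ := hstep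
    have hWe := hW e he
    have hends : s e ∈ W ∧ t e ∈ W := by
      rcases hab with ⟨rfl, rfl⟩ | ⟨rfl, rfl⟩
      · exact ⟨ih.1, hWe.1 ih.1⟩
      · exact ⟨hWe.2 ih.1, ih.1⟩
    refine ⟨?_, ih.2.tail ⟨e, by simpa [_root_.inEdges] using hends, hab⟩⟩
    rcases hab with ⟨_, rfl⟩ | ⟨rfl, _⟩
    exacts [hends.2, hends.1]

/-- A connected spanning edge set has at least `|V| - 1` edges. -/
theorem ConnOn.card_le [Fintype V] (h : ConnOn s t F Finset.univ) :
    Fintype.card V ≤ F.card + 1 := by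
  let G : SimpleGraph V := SimpleGraph.fromEdgeSet (F.image fun e => s(s e, t e) : Finset (Sym2 V))
  have hreach : ∀ a b, Reach s t F a b → G.Reachable a b := by
    intro a b hab
    induction hab with
    | refl => exact SimpleGraph.Reachable.refl _
    | @tail b c _ hstep ih =>
      obtain ⟨e, he, hbc⟩ := hstep
      by_cases hne : b = c
      · exact hne ▸ ih
      · refine ih.trans (SimpleGraph.Adj.reachable ?_)
        rw [SimpleGraph.fromEdgeSet_adj]
        refine ⟨?_, hne⟩
        rw [Finset.mem_coe, Finset.mem_image]
        exact ⟨e, he, by rw [Sym2.eq_iff]; exact hbc⟩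
  have hG : G.Connected :=
    { preconnected := fun a b => hreach a b (h.2 a (Finset.mem_univ a) b (Finset.mem_univ b))
      nonempty := ⟨h.1.choose⟩ }
  have hsub : G.edgeSet ⊆ (F.image fun e => s(s e, t e) : Finset (Sym2 V)) := by
    rw [SimpleGraph.edgeSet_fromEdgeSet]
    exact Set.sdiff_subset
  calc Fintype.card V = Nat.card V := Nat.card_eq_fintype_card.symm
    _ ≤ Nat.card G.edgeSet + 1 := hG.card_vert_le_card_edgeSet_add_one
    _ ≤ F.card + 1 := by
      gcongr
      calc Nat.card G.edgeSet = G.edgeSet.ncard := rfl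
        _ ≤ (F.image fun e => s(s e, t e)).card := by
          rw [← Set.ncard_coe_finset]
          exact Set.ncard_le_ncard hsub (Finset.finite_toSet _)
        _ ≤ F.card := Finset.card_image_le

end Reachability

theorem cutEdges_compl {V E : Type*} [Fintype V] [Fintype E] [DecidableEq V]
    (s t : E → V) (W : Finset V) : cutEdges s t Wᶜ = cutEdges s t W := by
  ext e
  simp only [cutEdges, Finset.mem_filter, Finset.mem_univ, Finset.mem_compl, true_and, not_not]
  tauto

section SpanningTree

variable {V E : Type*} [Fintype V] [DecidableEq E] {s t : E → V} {T : Finset E}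

theorem mem_treeSide {e : E} {v : V} :
    v ∈ treeSide s t T e ↔ Reach s t (T.erase e) (s e) v := by
  simp [treeSide]

theorem mem_treeSide_iff_of_mem_erase {e f : E} (hf : f ∈ T.erase e) :
    s f ∈ treeSide s t T e ↔ t f ∈ treeSide s t T e := by
  rw [mem_treeSide, mem_treeSide]
  exact ⟨fun h => h.trans (Reach.of_edge hf), fun h => h.trans (Reach.of_edge hf).symm⟩

theorem IsSpanningTree.target_notMem_treeSide (hT : IsSpanningTree s t T) {e : E} (he : e ∈ T) :
    t e ∉ treeSide s t T e := by
  rw [mem_treeSide]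
  intro hte
  have hall : ∀ v, Reach s t (T.erase e) (s e) v := fun v =>
    (Reach.erase (hT.1.2 (s e) (Finset.mem_univ _) v (Finset.mem_univ _))).elim id
      fun h => hte.trans h
  have hcard := ConnOn.card_le (s := s) (t := t) (F := T.erase e)
    ⟨hT.1.1, fun a _ b _ => (hall a).symm.trans (hall b)⟩
  have := Finset.card_erase_add_one he
  have := hT.2
  omega

/-- The fundamental cut of an edge of a spanning tree is a cocycle. -/
theorem IsSpanningTree.biconn_treeSide [Fintype E] [DecidableEq V] (hT : IsSpanningTree s t T) {e : E}
    (he : e ∈ T) : Biconn s t (treeSide s t T e) := by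
  have hclosed : ∀ f ∈ T.erase e, (s f ∈ treeSide s t T e ↔ t f ∈ treeSide s t T e) :=
    fun _ => mem_treeSide_iff_of_mem_erase
  constructor
  · refine ⟨⟨s e, mem_treeSide.2 Relation.ReflTransGen.refl⟩, fun a ha b hb => ?_⟩
    exact (Reach.inEdges hclosed ha
      ((mem_treeSide.1 ha).symm.trans (mem_treeSide.1 hb))).2
  · have hreach : ∀ v ∈ (treeSide s t T e)ᶜ, Reach s t (T.erase e) (t e) v := fun v hv =>
      (Reach.erase (hT.1.2 (s e) (Finset.mem_univ _) v (Finset.mem_univ _))).resolve_left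
        fun h => Finset.mem_compl.1 hv (mem_treeSide.2 h)
    refine ⟨⟨t e, Finset.mem_compl.2 (hT.target_notMem_treeSide he)⟩, fun a ha b hb => ?_⟩
    refine (Reach.inEdges (fun f hf => ?_) ha ((hreach a ha).symm.trans (hreach b hb))).2
    rw [Finset.mem_compl, Finset.mem_compl, not_iff_not]
    exact hclosed f hf

theorem cutEdges_treeSide_inter_subset [Fintype E] [DecidableEq V] (e : E) :
    cutEdges s t (treeSide s t T e) ∩ T ⊆ {e} := by
  intro f hf
  rw [Finset.mem_inter, cutEdges, Finset.mem_filter] at hf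
  by_contra hne
  have := mem_treeSide_iff_of_mem_erase (s := s) (t := t)
    (Finset.mem_erase.2 ⟨by simpa using hne, hf.2⟩)
  tauto

end SpanningTree

section Statements

variable {V E : Type*} [Fintype V] [Fintype E] [DecidableEq V] [DecidableEq E]

/-- If triangulating cocycle signatures `σ1*`, `σ2*` differ by a cocycle flip
at the cocycle `C* = E(W0,W0ᶜ)`, then every spanning tree `T` whose edges in `C* ∩ T` are all
directed in `σ1*(C*(T,e))` as in `σ1*(C*)` contains exactly one edge of `C*`. -/
theorem stmt_12 (s t : E → V) (hloop : ∀ e, s e ≠ t e)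
    (hconn : ConnOn s t Finset.univ Finset.univ)
    (σ1 σ2 : Finset V → Bool)
    (hsig1 : IsSignature s t σ1) (hsig2 : IsSignature s t σ2)
    (htri1 : Triangulating s t σ1) (htri2 : Triangulating s t σ2)
    (W0 : Finset V) (hbi0 : Biconn s t W0)
    (hflip : σ2 W0 = ! σ1 W0)
    (hsame : ∀ W : Finset V, Biconn s t W → W ≠ W0 → W ≠ W0ᶜ → σ1 W = σ2 W) :
    ∀ T : Finset E, IsSpanningTree s t T →
      (∀ e ∈ cutEdges s t W0 ∩ T,
        (ohead s t (sigmaOrient s t σ1 T) e ∈ W0 ↔ σ1 W0 = true)) →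
      (cutEdges s t W0 ∩ T).card = 1 := by
  intro T hT horient
  by_cases hfund : ∃ e ∈ cutEdges s t W0 ∩ T, treeSide s t T e = W0 ∨ treeSide s t T e = W0ᶜ
  · obtain ⟨e, he, hside⟩ := hfund
    have hcut : cutEdges s t (treeSide s t T e) = cutEdges s t W0 := by
      rcases hside with h | h
      · rw [h]
      · rw [h, cutEdges_compl]
    rw [Finset.card_eq_one]
    exact ⟨e, Finset.Subset.antisymm (hcut ▸ cutEdges_treeSide_inter_subset e)
      (Finset.singleton_subset_iff.2 he)⟩
  · push Not at hfund
    have hσ2 : σ2 W0 = σ1 W0 := htri2 T hT W0 hbi0 (σ1 W0) fun e he => by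
      have heq : σ1 (treeSide s t T e) = σ2 (treeSide s t T e) :=
        hsame _ (hT.biconn_treeSide (Finset.mem_inter.1 he).2) (hfund e he).1 (hfund e he).2
      rw [← horient e he, ohead, ohead, sigmaOrient, sigmaOrient, heq]
    rw [hflip] at hσ2
    exact absurd hσ2 (Bool.not_ne_self _)

end Statements
end
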